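/- Let n, k, d ≥ 1 and let C be a real n×k matrix satisfying ‖Cu‖₂ ≤ 1 for every vector u ∈ {−1, 1}^k. Then for every real k×d matrix G each of whose rows has ℓ₁-norm at most 1, one has ‖CG‖_F ≤ 1. -/

import Mathlib

open Matrix

/-- Euclidean norm of a finite real vector. -/
noncomputable def eucNorm {m : ℕ} (x : Fin m → ℝ) : ℝ :=
  Real.sqrt (∑ i, (x i) ^ 2)

/-- Frobenius norm of a real matrix. -/
noncomputable def frobNorm {m l : ℕ} (M : Matrix (Fin m) (Fin l) ℝ) : ℝ :=
  Real.sqrt (∑ i, ∑ j, (M i j) ^ 2)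

/-- Signs can be chosen greedily so that the squared norm of a signed sum of vectors is at least
the sum of the squared norms. -/
theorem exists_signs_sum_norm_sq_le {ι E : Type*} [NormedAddCommGroup E] [InnerProductSpace ℝ E]
    (x : ι → E) (s : Finset ι) :
    ∃ ε : ι → ℝ, (∀ j, ε j = 1 ∨ ε j = -1) ∧
      ∑ j ∈ s, ‖x j‖ ^ 2 ≤ ‖∑ j ∈ s, ε j • x j‖ ^ 2 := by
  classical
  induction s using Finset.induction_on with
  | empty => exact ⟨fun _ => 1, fun _ => Or.inl rfl, by simp⟩
  | insert a s ha ih =>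
    obtain ⟨ε, hε, h⟩ := ih
    obtain ⟨σ, hσ, hinner⟩ : ∃ σ : ℝ, (σ = 1 ∨ σ = -1) ∧
        0 ≤ inner ℝ (σ • x a) (∑ j ∈ s, ε j • x j) := by
      rcases le_total 0 (inner ℝ (x a) (∑ j ∈ s, ε j • x j)) with h0 | h0
      · exact ⟨1, Or.inl rfl, by rwa [one_smul]⟩
      · exact ⟨-1, Or.inr rfl, by rw [neg_one_smul, inner_neg_left]; linarith⟩
    refine ⟨Function.update ε a σ, fun j => ?_, ?_⟩
    · by_cases hj : j = a
      · subst hj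
        simpa using hσ
      · simpa [hj] using hε j
    · have hsum : ∑ j ∈ s, Function.update ε a σ j • x j = ∑ j ∈ s, ε j • x j :=
        Finset.sum_congr rfl fun j hj => by
          rw [Function.update_of_ne (ne_of_mem_of_not_mem hj ha)]
      have hnorm : ‖σ • x a‖ = ‖x a‖ := by
        rcases hσ with rfl | rfl <;> simp
      rw [Finset.sum_insert ha, Finset.sum_insert ha, hsum, Function.update_self,
        norm_add_sq_real, hnorm]
      linarith

/-- The cube is the convex hull of its sign vectors. -/
theorem mem_convexHull_signs {ι : Type*} [Finite ι] {v : ι → ℝ} (hv : ∀ i, |v i| ≤ 1) :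
    v ∈ convexHull ℝ {u : ι → ℝ | ∀ i, u i = 1 ∨ u i = -1} := by
  have hset : {u : ι → ℝ | ∀ i, u i = 1 ∨ u i = -1} =
      Set.univ.pi fun _ => ({1, -1} : Set ℝ) := by
    ext u
    simp
  rw [hset, convexHull_pi]
  intro i _
  rw [convexHull_pair, segment_symm, segment_eq_Icc (by norm_num)]
  exact abs_le.mp (hv i)

theorem eucNorm_eq_norm {m : ℕ} (x : Fin m → ℝ) : eucNorm x = ‖WithLp.toLp 2 x‖ := by
  simp [eucNorm, EuclideanSpace.norm_eq]

/-- A bound on the image of all sign vectors extends to the whole cube. -/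
theorem eucNorm_mulVec_le_of_signs {n k : ℕ} {C : Matrix (Fin n) (Fin k) ℝ} {r : ℝ}
    (hC : ∀ u : Fin k → ℝ, (∀ i, u i = 1 ∨ u i = -1) → eucNorm (C.mulVec u) ≤ r)
    {v : Fin k → ℝ} (hv : ∀ i, |v i| ≤ 1) : eucNorm (C.mulVec v) ≤ r := by
  let L : (Fin k → ℝ) →ₗ[ℝ] EuclideanSpace ℝ (Fin n) :=
    (WithLp.linearEquiv 2 ℝ (Fin n → ℝ)).symm.toLinearMap ∘ₗ C.mulVecLin
  have hL : ∀ u, eucNorm (C.mulVec u) = ‖L u‖ := fun u => eucNorm_eq_norm _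
  have hconv : Convex ℝ (L ⁻¹' Metric.closedBall 0 r) :=
    (convex_closedBall (0 : EuclideanSpace ℝ (Fin n)) r).linear_preimage L
  have hsub := convexHull_min (s := {u : Fin k → ℝ | ∀ i, u i = 1 ∨ u i = -1})
    (fun u hu => by simpa [← hL] using hC u hu) hconv
  simpa [← hL] using hsub (mem_convexHull_signs hv)

theorem frobenius_bound_of_sign_vectors_l1_rows
    (n k d : ℕ) (hn : 1 ≤ n) (hk : 1 ≤ k) (hd : 1 ≤ d)
    (C : Matrix (Fin n) (Fin k) ℝ)
    (hC : ∀ u : Fin k → ℝ, (∀ i, u i = 1 ∨ u i = -1) → eucNorm (C.mulVec u) ≤ 1)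
    (G : Matrix (Fin k) (Fin d) ℝ)
    (hG : ∀ i : Fin k, ∑ j, |G i j| ≤ 1) :
    frobNorm (C * G) ≤ 1 := by
  obtain ⟨ε, hε, h⟩ :=
    exists_signs_sum_norm_sq_le (fun j => WithLp.toLp 2 fun i => (C * G) i j) Finset.univ
  have habs : ∀ j, |ε j| = 1 := fun j => by rcases hε j with h | h <;> simp [h]
  have hcube : ∀ i, |G.mulVec ε i| ≤ 1 := fun i =>
    calc |G.mulVec ε i| ≤ ∑ j, |G i j * ε j| :=
          Finset.abs_sum_le_sum_abs (fun j => G i j * ε j) Finset.univ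
      _ = ∑ j, |G i j| := by simp [abs_mul, habs]
      _ ≤ 1 := hG i
  have hbound := eucNorm_mulVec_le_of_signs hC hcube
  have hsum : ∑ j, ε j • WithLp.toLp 2 (fun i => (C * G) i j) =
      WithLp.toLp 2 (C.mulVec (G.mulVec ε)) := by
    ext i
    rw [Matrix.mulVec_mulVec]
    simp [Matrix.mulVec, dotProduct, mul_comm (ε _)]
  rw [hsum, ← eucNorm_eq_norm] at h
  have hfrob : ∑ i, ∑ j, ((C * G) i j) ^ 2 = ∑ j, ‖WithLp.toLp 2 fun i => (C * G) i j‖ ^ 2 := by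
    rw [Finset.sum_comm]
    simp [EuclideanSpace.norm_sq_eq]
  rw [frobNorm, Real.sqrt_le_one, hfrob]
  exact h.trans (pow_le_one₀ (Real.sqrt_nonneg _) hbound)
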